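/- The seven-step stepsize pattern h = (3/2, 11/5, 3/2, 12, 3/2, 11/5, 3/2) is 10⁻⁹-straightforward with parameter Δ = 10⁻⁵. Consequently, for every convex L-smooth f : ℝ^n → ℝ with a minimizer x_⋆, every x_0 with D := sup{‖x − x_⋆‖₂ : f(x) ≤ f(x_0)} finite, and gradient descent with pattern h from x_0, there exists a constant C ≥ 0 such that for every T > 0 divisible by 7, f(x_T) − f(x_⋆) ≤ L·D² / ((16/5 − 10⁻⁹)·T) + C/T². -/

import Mathlib

open scoped BigOperators

noncomputable section

/-- `ℝ^n` with the Euclidean norm. -/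
abbrev E (n : ℕ) : Type := EuclideanSpace ℝ (Fin n)

/-- A differentiable `f : ℝ^n → ℝ` is `L`-smooth if its gradient is `L`-Lipschitz. -/
def IsLSmooth {n : ℕ} (L : ℝ) (f : E n → ℝ) : Prop :=
  Differentiable ℝ f ∧ ∀ x y : E n, ‖gradient f x - gradient f y‖ ≤ L * ‖x - y‖

/-- A stepsize pattern `h` (of length `t`, given as the first `t` values of `h : ℕ → ℝ`)
is `ε`-straightforward with parameter `Δ`: for every dimension `n`, every `L, D > 0`,
every `δ ∈ [0, L·D²·Δ]`, every convex `L`-smooth `g` with minimizer `ystar`, and every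
initialization `y 0` with `‖y 0 - ystar‖ ≤ D` and `g (y 0) - g ystar ≤ δ`, one pass of
gradient descent through the pattern satisfies
`g (y t) - g ystar ≤ δ - (Σ_{i<t}(h i - ε)/(L·D²))·δ²`. -/
def IsStraightforward (t : ℕ) (h : ℕ → ℝ) (ε Δ : ℝ) : Prop :=
  ∀ (n : ℕ) (L D δ : ℝ), 0 < L → 0 < D → 0 ≤ δ → δ ≤ L * D ^ 2 * Δ →
    ∀ g : E n → ℝ, ConvexOn ℝ Set.univ g → IsLSmooth L g →
      ∀ ystar : E n, (∀ z, g ystar ≤ g z) →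
        ∀ y : ℕ → E n, ‖y 0 - ystar‖ ≤ D → g (y 0) - g ystar ≤ δ →
          (∀ k < t, y (k + 1) = y k - (h k / L) • gradient g (y k)) →
          g (y t) - g ystar ≤ δ - ((∑ i ∈ Finset.range t, (h i - ε)) / (L * D ^ 2)) * δ ^ 2



theorem line_hasDerivAt {n : ℕ} {g : E n → ℝ} (hg : Differentiable ℝ g) (a b : E n) (t : ℝ) :
    HasDerivAt (fun t : ℝ => g (a + t • b)) (inner ℝ (gradient g (a + t • b)) b) t := by
  have h1 : HasDerivAt (fun t : ℝ => a + t • b) b t := by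
    simpa using ((hasDerivAt_id t).smul_const b).const_add a
  have h2 := ((hg (a + t • b)).hasGradientAt.hasFDerivAt).comp_hasDerivAt t h1
  have e : (inner ℝ (gradient g (a + t • b)) b : ℝ)
      = (InnerProductSpace.toDual ℝ (E n) (gradient g (a + t • b))) b := by simp
  rw [e]
  exact h2

theorem convex_lower {n : ℕ} {g : E n → ℝ} (hc : ConvexOn ℝ Set.univ g)
    (hg : Differentiable ℝ g) (a b : E n) :
    g a + inner ℝ (gradient g a) (b - a) ≤ g b := by
  have hd := line_hasDerivAt hg a (b - a) 0
  have hcv : ConvexOn ℝ Set.univ (fun t : ℝ => g (a + t • (b - a))) := by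
    have := hc.comp_affineMap (AffineMap.lineMap a b : ℝ →ᵃ[ℝ] E n)
    refine (this.congr ?_)
    intro t _
    simp [AffineMap.lineMap_apply, add_comm]
  have := hcv.le_slope_of_hasDerivAt (Set.mem_univ 0) (Set.mem_univ 1) zero_lt_one hd
  simp [slope_def_field] at this ⊢
  linarith

theorem descent_lem {n : ℕ} {L : ℝ} {g : E n → ℝ} (hs : IsLSmooth L g) (a b : E n) :
    g b ≤ g a + inner ℝ (gradient g a) (b - a) + L / 2 * ‖b - a‖ ^ 2 := by
  set v := b - a with hv
  have hd : ∀ t : ℝ, HasDerivAt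
      (fun t : ℝ => g (a + t • v) - t * inner ℝ (gradient g a) v - L / 2 * ‖v‖ ^ 2 * t ^ 2)
      (inner ℝ (gradient g (a + t • v)) v - inner ℝ (gradient g a) v
        - L / 2 * ‖v‖ ^ 2 * (2 * t)) t := by
    intro t
    have h1 := line_hasDerivAt hs.1 a v t
    have h2 := (hasDerivAt_id t).mul_const (inner ℝ (gradient g a) v)
    have h3 := (hasDerivAt_pow 2 t).const_mul (L / 2 * ‖v‖ ^ 2)
    have h4 := (h1.sub h2).sub h3
    refine h4.congr_deriv ?_
    norm_num
  have hanti := antitoneOn_of_deriv_nonpos (convex_Icc (0 : ℝ) 1)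
    (fun t _ => (hd t).continuousAt.continuousWithinAt)
    (fun t _ => (hd t).differentiableAt.differentiableWithinAt) (by
      intro t ht
      rw [interior_Icc] at ht
      rw [(hd t).deriv, ← inner_sub_left]
      have h1 := real_inner_le_norm (gradient g (a + t • v) - gradient g a) v
      have h2 := hs.2 (a + t • v) a
      have h3 : ‖a + t • v - a‖ = t * ‖v‖ := by
        rw [add_sub_cancel_left, norm_smul, Real.norm_of_nonneg ht.1.le]
      rw [h3] at h2
      have h4 := mul_le_mul_of_nonneg_right h2 (norm_nonneg v)
      nlinarith)
  have := hanti (by simp : (0 : ℝ) ∈ Set.Icc (0 : ℝ) 1) (by simp : (1 : ℝ) ∈ Set.Icc (0 : ℝ) 1)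
    zero_le_one
  simp [hv] at this ⊢
  linarith

theorem interpolation {n : ℕ} {L : ℝ} (hL : 0 < L) {g : E n → ℝ} (hc : ConvexOn ℝ Set.univ g)
    (hs : IsLSmooth L g) (x y : E n) :
    inner ℝ ((1 / L) • gradient g y) (x - y)
      + 1 / 2 * ‖(1 / L) • gradient g x - (1 / L) • gradient g y‖ ^ 2 ≤ (g x - g y) / L := by
  set w := (1 / L) • gradient g x - (1 / L) • gradient g y with hw
  have h1 := convex_lower hc hs.1 y (x - w)
  have h2 := descent_lem hs x (x - w)
  have e1 : x - w - x = -w := by abel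
  have e2 : x - w - y = (x - y) - w := by abel
  rw [e1, norm_neg, inner_neg_right] at h2
  rw [e2, inner_sub_right] at h1
  have e3 : inner ℝ (gradient g x) w - inner ℝ (gradient g y) w = L * ‖w‖ ^ 2 := by
    rw [← inner_sub_left, ← real_inner_self_eq_norm_sq, ← real_inner_smul_left]
    congr 1
    rw [hw, ← smul_sub, smul_smul]
    field_simp
    simp
  rw [le_div_iff₀ hL, real_inner_smul_left]
  field_simp
  linarith

theorem form_zero_nonneg (d0 d1 d2 d3 d4 d5 d6 d7 : ℝ) :
    0 ≤ (3 / 2000) * d0 * d0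
      + (3 / 2000) * d0 * d1
      + (79 / 200) * d1 * d1
      + (519 / 2000) * d1 * d2
      + (-159 / 200) * d1 * d3
      + (113 / 2000) * d2 * d2
      + (-211 / 1000) * d2 * d3
      + (5871 / 1000) * d3 * d3
      + (2849 / 2000) * d3 * d4
      + (3861 / 1250) * d3 * d5
      + (6787 / 2000) * d3 * d6
      + (1573 / 500) * d3 * d7
      + (211 / 2000) * d4 * d4
      + (4033 / 10000) * d4 * d5
      + (207 / 500) * d4 * d6
      + (861 / 2000) * d4 * d7
      + (93 / 200) * d5 * d5
      + (2503 / 2500) * d5 * d6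
      + (4351 / 5000) * d5 * d7
      + (72 / 125) * d6 * d6
      + (1983 / 2000) * d6 * d7
      + (511 / 1000) * d7 * d7 := by
  have key : (3 / 2000) * d0 * d0
      + (3 / 2000) * d0 * d1
      + (79 / 200) * d1 * d1
      + (519 / 2000) * d1 * d2
      + (-159 / 200) * d1 * d3
      + (113 / 2000) * d2 * d2
      + (-211 / 1000) * d2 * d3
      + (5871 / 1000) * d3 * d3
      + (2849 / 2000) * d3 * d4
      + (3861 / 1250) * d3 * d5
      + (6787 / 2000) * d3 * d6
      + (1573 / 500) * d3 * d7
      + (211 / 2000) * d4 * d4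
      + (4033 / 10000) * d4 * d5
      + (207 / 500) * d4 * d6
      + (861 / 2000) * d4 * d7
      + (93 / 200) * d5 * d5
      + (2503 / 2500) * d5 * d6
      + (4351 / 5000) * d5 * d7
      + (72 / 125) * d6 * d6
      + (1983 / 2000) * d6 * d7
      + (511 / 1000) * d7 * d7
      = (3 / 2000) * (d0 + (1 / 2) * d1)^2
      + (3157 / 8000) * (d1 + (1038 / 3157) * d2 + (-3180 / 3157) * d3)^2
      + (4369 / 315700) * (d2 + (619 / 340) * d3)^2
      + (3688819 / 680000) * (d3 + (484330 / 3688819) * d4 + (1050192 / 3688819) * d5 + (1153790 / 3688819) * d6 + (1069640 / 3688819) * d7)^2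
      + (22103181 / 1844409500) * (d4 + (-82978013 / 884127240) * d5 + (-116402789 / 88412724) * d6 + (128668799 / 176825448) * d7)^2
      + (445775978189 / 17682544800000) * (d5 + (284004225650 / 445775978189) * d6 + (-210570567355 / 445775978189) * d7)^2
      + (12735421244589 / 891551956378000) * (d6 + (40680189041051 / 25470842489178) * d7)^2
      + (131884927304207 / 20376673991342400) * (d7)^2 := by ring
  rw [key]
  positivity

theorem form_delta_nonneg (d0 d1 d2 d3 d4 d5 d6 d7 z : ℝ) :
    0 ≤ (255209 / 200000000) * d0 * d0
      + (102389 / 80000000) * d0 * d1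
      + (969 / 400000000) * d0 * d2
      + (20427 / 62500000) * d0 * d3
      + (86499 / 2000000000) * d0 * d4
      + (37761 / 400000000) * d0 * d5
      + (104283 / 1000000000) * d0 * d6
      + (96903 / 1000000000) * d0 * d7
      + (9 / 200000000) * d0 * z
      + (78958921 / 200000000) * d1 * d1
      + (259869079 / 1000000000) * d1 * d2
      + (-124243851 / 156250000) * d1 * d3
      + (317163 / 5000000000) * d1 * d4
      + (138457 / 1000000000) * d1 * d5
      + (382371 / 2500000000) * d1 * d6
      + (355311 / 2500000000) * d1 * d7
      + (29787 / 400000000) * d1 * z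
      + (2822811 / 50000000) * d2 * d2
      + (-105897529 / 500000000) * d2 * d3
      + (86499 / 2000000000) * d2 * d4
      + (37761 / 400000000) * d2 * d5
      + (104283 / 1000000000) * d2 * d6
      + (96903 / 1000000000) * d2 * d7
      + (-344557 / 2000000000) * d2 * z
      + (1467968527 / 250000000) * d3 * d3
      + (1424678833 / 1000000000) * d3 * d4
      + (617596587 / 200000000) * d3 * d5
      + (1696859761 / 500000000) * d3 * d6
      + (1573082301 / 500000000) * d3 * d7
      + (2163089 / 2500000000) * d3 * z
      + (211 / 2000) * d4 * d4
      + (8063 / 20000) * d4 * d5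
      + (207 / 500) * d4 * d6
      + (861 / 2000) * d4 * d7
      + (893823 / 5000000000) * d4 * z
      + (4649 / 10000) * d5 * d5
      + (25027 / 25000) * d5 * d6
      + (4351 / 5000) * d5 * d7
      + (-959803 / 1000000000) * d5 * z
      + (5759 / 10000) * d6 * d6
      + (19829 / 20000) * d6 * d7
      + (527591 / 2500000000) * d6 * z
      + (5109 / 10000) * d7 * d7
      + (626331 / 2500000000) * d7 * z
      + (7 / 31250) * z * z := by
  have key : (255209 / 200000000) * d0 * d0
      + (102389 / 80000000) * d0 * d1
      + (969 / 400000000) * d0 * d2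
      + (20427 / 62500000) * d0 * d3
      + (86499 / 2000000000) * d0 * d4
      + (37761 / 400000000) * d0 * d5
      + (104283 / 1000000000) * d0 * d6
      + (96903 / 1000000000) * d0 * d7
      + (9 / 200000000) * d0 * z
      + (78958921 / 200000000) * d1 * d1
      + (259869079 / 1000000000) * d1 * d2
      + (-124243851 / 156250000) * d1 * d3
      + (317163 / 5000000000) * d1 * d4
      + (138457 / 1000000000) * d1 * d5
      + (382371 / 2500000000) * d1 * d6
      + (355311 / 2500000000) * d1 * d7
      + (29787 / 400000000) * d1 * z
      + (2822811 / 50000000) * d2 * d2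
      + (-105897529 / 500000000) * d2 * d3
      + (86499 / 2000000000) * d2 * d4
      + (37761 / 400000000) * d2 * d5
      + (104283 / 1000000000) * d2 * d6
      + (96903 / 1000000000) * d2 * d7
      + (-344557 / 2000000000) * d2 * z
      + (1467968527 / 250000000) * d3 * d3
      + (1424678833 / 1000000000) * d3 * d4
      + (617596587 / 200000000) * d3 * d5
      + (1696859761 / 500000000) * d3 * d6
      + (1573082301 / 500000000) * d3 * d7
      + (2163089 / 2500000000) * d3 * z
      + (211 / 2000) * d4 * d4
      + (8063 / 20000) * d4 * d5
      + (207 / 500) * d4 * d6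
      + (861 / 2000) * d4 * d7
      + (893823 / 5000000000) * d4 * z
      + (4649 / 10000) * d5 * d5
      + (25027 / 25000) * d5 * d6
      + (4351 / 5000) * d5 * d7
      + (-959803 / 1000000000) * d5 * z
      + (5759 / 10000) * d6 * d6
      + (19829 / 20000) * d6 * d7
      + (527591 / 2500000000) * d6 * z
      + (5109 / 10000) * d7 * d7
      + (626331 / 2500000000) * d7 * z
      + (7 / 31250) * z * z
      = (255209 / 200000000) * (d0 + (511945 / 1020836) * d1 + (969 / 1020836) * d2 + (163416 / 1276045) * d3 + (86499 / 5104180) * d4 + (37761 / 1020836) * d5 + (104283 / 2552090) * d6 + (96903 / 2552090) * d7 + (9 / 510418) * z)^2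
      + (322154348628799 / 816668800000000) * (d1 + (530564941886563 / 1610771743143995) * d2 + (-8118959336366304 / 8053858715719975) * d3 + (426129163761 / 8053858715719975) * d4 + (186026004379 / 1610771743143995) * d5 + (1027480724274 / 8053858715719975) * d6 + (954766976634 / 8053858715719975) * d7 + (30398426922 / 322154348628799) * z)^2
      + (10999846467277061047937 / 805385871571997500000000) * (d2 + (202043324626248666220433 / 109998464672770610479370) * d3 + (474514897592391839337 / 439993858691082441917480) * d4 + (5052407781391610123 / 2146311505810158253256) * d5 + (572074094100826578129 / 219996929345541220958740) * d6 + (531589002432346575189 / 219996929345541220958740) * d7 + (-79249819985109249490 / 10999846467277061047937) * z)^2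
      + (596730454520284316854848600773857 / 109998464672770610479370000000000) * (d3 + (313421103728553815742934932426613 / 2386921818081137267419394403095428) * d4 + (679338327633688905256928762160035 / 2386921818081137267419394403095428) * d5 + (373299277513576325487963115333021 / 1193460909040568633709697201547714) * d6 + (346068946134880615265071306046961 / 1193460909040568633709697201547714) * d7 + (71595512354028275785543360510 / 596730454520284316854848600773857) * z)^2
      + (1427994170804121827104397011058464676547 / 119346090904056863370969720154771400000000) * (d4 + (-138586653078057984153203880729762534085 / 1427994170804121827104397011058464676547) * d5 + (-1886720581511887121123231299422755578352 / 1427994170804121827104397011058464676547) * d6 + (345864131799415483900512228052283779706 / 475998056934707275701465670352821558849) * d7 + (479877242458618977457882719602078228 / 1427994170804121827104397011058464676547) * z)^2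
      + (2896861021569462952854133121554390952044619 / 114239533664329746168351760884677174123760000) * (d5 + (9178570290346293172025805768383863409786537 / 14484305107847314764270665607771954760223095) * d6 + (-1344048384576132177120849070715787383955792 / 2896861021569462952854133121554390952044619) * d7 + (-379578003952544472961463578971513249881828 / 14484305107847314764270665607771954760223095) * z)^2
      + (20391615757434668203750549248156274551050369937 / 1448430510784731476427066560777195476022309500000) * (d6 + (21853342547777749652979996735616983509164012785 / 13594410504956445469167032832104183034033579958) * d7 + (951912574072092659896696565123300590986928229 / 40783231514869336407501098496312549102100739874) * z)^2
      + (3588585668847738942069484708190714033786272998903 / 543776420198257818766681313284167321361343198320000) * (d7 + (-490874147096116714888690795801077516973181451097 / 3588585668847738942069484708190714033786272998903) * z)^2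
      + (2678646432335172020089567127237344165956598897 / 35885856688477389420694847081907140337862729989030) * (z)^2 := by ring
  rw [key]
  positivity

theorem scalar_certificate (s x0 x1 x2 x3 x4 x5 x6 x7 u0 u1 u2 u3 u4 u5 u6 u7 : ℝ) (hs0 : 0 ≤ s) (hs1 : s ≤ 1 / 100000)
    (h1 : x1 = x0 - (3 / 2) * u0) (h2 : x2 = x1 - (11 / 5) * u1) (h3 : x3 = x2 - (3 / 2) * u2) (h4 : x4 = x3 - 12 * u3) (h5 : x5 = x4 - (3 / 2) * u4) (h6 : x6 = x5 - (11 / 5) * u5) (h7 : x7 = x6 - (3 / 2) * u6) :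
    0 ≤ 112 / 5 * s ^ 2 * x0 ^ 2
      + ((1997 / 1000) + (-89591 / 2000) * s) * (u1 * (x0 - x1) + 1 / 2 * (u0 - u1) ^ 2)
      + ((997 / 1000) + 0 * s) * (u0 * (x1 - x0) + 1 / 2 * (u1 - u0) ^ 2)
      + ((377 / 200) + (10921 / 2000) * s) * (u2 * (x1 - x2) + 1 / 2 * (u1 - u2) ^ 2)
      + ((9 / 20) + (-70) * s) * (u3 * (x1 - x3) + 1 / 2 * (u1 - u3) ^ 2)
      + ((2771 / 500) + (12811 / 500) * s) * (u3 * (x2 - x3) + 1 / 2 * (u2 - u3) ^ 2)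
      + ((267 / 200) + (-20) * s) * (u1 * (x3 - x1) + 1 / 2 * (u3 - u1) ^ 2)
      + ((3657 / 1000) + 20 * s) * (u2 * (x3 - x2) + 1 / 2 * (u3 - u2) ^ 2)
      + ((131 / 1000) + (-28833 / 10000) * s) * (u4 * (x3 - x4) + 1 / 2 * (u3 - u4) ^ 2)
      + ((283 / 1000) + (-32587 / 2000) * s) * (u5 * (x3 - x5) + 1 / 2 * (u3 - u5) ^ 2)
      + ((31 / 100) + (-34761 / 5000) * s) * (u6 * (x3 - x6) + 1 / 2 * (u3 - u6) ^ 2)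
      + ((287 / 1000) + (-32301 / 5000) * s) * (u7 * (x3 - x7) + 1 / 2 * (u3 - u7) ^ 2)
      + ((91 / 500) + 0 * s) * (u5 * (x4 - x5) + 1 / 2 * (u4 - u5) ^ 2)
      + ((133 / 500) + (-10) * s) * (u6 * (x5 - x6) + 1 / 2 * (u5 - u6) ^ 2)
      + ((199 / 1000) + 0 * s) * (u7 * (x5 - x7) + 1 / 2 * (u5 - u7) ^ 2)
      + ((51 / 1000) + 0 * s) * (u4 * (x6 - x4) + 1 / 2 * (u6 - u4) ^ 2)
      + ((21 / 40) + (-10) * s) * (u7 * (x6 - x7) + 1 / 2 * (u6 - u7) ^ 2)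
      + ((11 / 1000) + (-10) * s) * (u3 * (x7 - x3) + 1 / 2 * (u7 - u3) ^ 2)
      + (9 / 2000) * s * (u0 * (0 - x0) + 1 / 2 * (0 - u0) ^ 2)
      + (32 / 125) * s * (u1 * (0 - x1) + 1 / 2 * (0 - u1) ^ 2)
      + (323 / 2000) * s * (u2 * (0 - x2) + 1 / 2 * (0 - u2) ^ 2)
      + (13618 / 625) * s * (u3 * (0 - x3) + 1 / 2 * (0 - u3) ^ 2)
      + (28833 / 10000) * s * (u4 * (0 - x4) + 1 / 2 * (0 - u4) ^ 2)
      + (12587 / 2000) * s * (u5 * (0 - x5) + 1 / 2 * (0 - u5) ^ 2)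
      + (34761 / 5000) * s * (u6 * (0 - x6) + 1 / 2 * (0 - u6) ^ 2)
      + (32301 / 5000) * s * (u7 * (0 - x7) + 1 / 2 * (0 - u7) ^ 2) := by
  have q0 := form_zero_nonneg (u0 - s * x0) (u1 - s * x0) (u2 - s * x0) (u3 - s * x0) (u4 - s * x0) (u5 - s * x0) (u6 - s * x0) (u7 - s * x0)
  have q1 := form_delta_nonneg (u0 - s * x0) (u1 - s * x0) (u2 - s * x0) (u3 - s * x0) (u4 - s * x0) (u5 - s * x0) (u6 - s * x0) (u7 - s * x0) (s * x0)
  have m0 := mul_nonneg (sub_nonneg.2 (show 100000 * s ≤ 1 by linarith)) q0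
  have m1 := mul_nonneg (show 0 ≤ 100000 * s by linarith) q1
  have m := add_nonneg m0 m1
  subst h1 h2 h3 h4 h5 h6 h7
  refine le_of_le_of_eq m ?_
  ring

theorem inner_eq_sum {n : ℕ} (x y : E n) : inner ℝ x y = ∑ i, x i * y i := by
  simp [PiLp.inner_apply, mul_comm]

theorem vector_certificate {n : ℕ} (s : ℝ) (x0 x1 x2 x3 x4 x5 x6 x7 u0 u1 u2 u3 u4 u5 u6 u7 : E n)
    (hs0 : 0 ≤ s) (hs1 : s ≤ 1 / 100000)
    (h1 : x1 = x0 - ((3 / 2) : ℝ) • u0)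
    (h2 : x2 = x1 - ((11 / 5) : ℝ) • u1)
    (h3 : x3 = x2 - ((3 / 2) : ℝ) • u2)
    (h4 : x4 = x3 - (12 : ℝ) • u3)
    (h5 : x5 = x4 - ((3 / 2) : ℝ) • u4)
    (h6 : x6 = x5 - ((11 / 5) : ℝ) • u5)
    (h7 : x7 = x6 - ((3 / 2) : ℝ) • u6) :
    0 ≤ 112 / 5 * s ^ 2 * ‖x0‖ ^ 2
      + ((1997 / 1000) + (-89591 / 2000) * s) * (inner ℝ u1 (x0 - x1) + 1 / 2 * ‖u0 - u1‖ ^ 2)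
      + ((997 / 1000) + 0 * s) * (inner ℝ u0 (x1 - x0) + 1 / 2 * ‖u1 - u0‖ ^ 2)
      + ((377 / 200) + (10921 / 2000) * s) * (inner ℝ u2 (x1 - x2) + 1 / 2 * ‖u1 - u2‖ ^ 2)
      + ((9 / 20) + (-70) * s) * (inner ℝ u3 (x1 - x3) + 1 / 2 * ‖u1 - u3‖ ^ 2)
      + ((2771 / 500) + (12811 / 500) * s) * (inner ℝ u3 (x2 - x3) + 1 / 2 * ‖u2 - u3‖ ^ 2)
      + ((267 / 200) + (-20) * s) * (inner ℝ u1 (x3 - x1) + 1 / 2 * ‖u3 - u1‖ ^ 2)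
      + ((3657 / 1000) + 20 * s) * (inner ℝ u2 (x3 - x2) + 1 / 2 * ‖u3 - u2‖ ^ 2)
      + ((131 / 1000) + (-28833 / 10000) * s) * (inner ℝ u4 (x3 - x4) + 1 / 2 * ‖u3 - u4‖ ^ 2)
      + ((283 / 1000) + (-32587 / 2000) * s) * (inner ℝ u5 (x3 - x5) + 1 / 2 * ‖u3 - u5‖ ^ 2)
      + ((31 / 100) + (-34761 / 5000) * s) * (inner ℝ u6 (x3 - x6) + 1 / 2 * ‖u3 - u6‖ ^ 2)
      + ((287 / 1000) + (-32301 / 5000) * s) * (inner ℝ u7 (x3 - x7) + 1 / 2 * ‖u3 - u7‖ ^ 2)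
      + ((91 / 500) + 0 * s) * (inner ℝ u5 (x4 - x5) + 1 / 2 * ‖u4 - u5‖ ^ 2)
      + ((133 / 500) + (-10) * s) * (inner ℝ u6 (x5 - x6) + 1 / 2 * ‖u5 - u6‖ ^ 2)
      + ((199 / 1000) + 0 * s) * (inner ℝ u7 (x5 - x7) + 1 / 2 * ‖u5 - u7‖ ^ 2)
      + ((51 / 1000) + 0 * s) * (inner ℝ u4 (x6 - x4) + 1 / 2 * ‖u6 - u4‖ ^ 2)
      + ((21 / 40) + (-10) * s) * (inner ℝ u7 (x6 - x7) + 1 / 2 * ‖u6 - u7‖ ^ 2)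
      + ((11 / 1000) + (-10) * s) * (inner ℝ u3 (x7 - x3) + 1 / 2 * ‖u7 - u3‖ ^ 2)
      + (9 / 2000) * s * (inner ℝ u0 (0 - x0) + 1 / 2 * ‖0 - u0‖ ^ 2)
      + (32 / 125) * s * (inner ℝ u1 (0 - x1) + 1 / 2 * ‖0 - u1‖ ^ 2)
      + (323 / 2000) * s * (inner ℝ u2 (0 - x2) + 1 / 2 * ‖0 - u2‖ ^ 2)
      + (13618 / 625) * s * (inner ℝ u3 (0 - x3) + 1 / 2 * ‖0 - u3‖ ^ 2)
      + (28833 / 10000) * s * (inner ℝ u4 (0 - x4) + 1 / 2 * ‖0 - u4‖ ^ 2)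
      + (12587 / 2000) * s * (inner ℝ u5 (0 - x5) + 1 / 2 * ‖0 - u5‖ ^ 2)
      + (34761 / 5000) * s * (inner ℝ u6 (0 - x6) + 1 / 2 * ‖0 - u6‖ ^ 2)
      + (32301 / 5000) * s * (inner ℝ u7 (0 - x7) + 1 / 2 * ‖0 - u7‖ ^ 2) := by
  have key := Finset.sum_nonneg (s := (Finset.univ : Finset (Fin n))) (fun i _ =>
    scalar_certificate s (x0 i) (x1 i) (x2 i) (x3 i) (x4 i) (x5 i) (x6 i) (x7 i) (u0 i) (u1 i) (u2 i) (u3 i) (u4 i) (u5 i) (u6 i) (u7 i) hs0 hs1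
      (by rw [h1]; simp) (by rw [h2]; simp) (by rw [h3]; simp) (by rw [h4]; simp) (by rw [h5]; simp) (by rw [h6]; simp) (by rw [h7]; simp))
  simp only [Finset.sum_add_distrib, ← Finset.mul_sum] at key
  simp only [inner_eq_sum, EuclideanSpace.real_norm_sq_eq, PiLp.sub_apply, PiLp.zero_apply]
  exact key

set_option maxHeartbeats 4000000 in
theorem assemble (s B X F0 F1 F2 F3 F4 F5 F6 F7 P01 P10 P12 P13 P23 P31 P32 P34 P35 P36 P37 P45 P56 P57 P64 P67 P73
    R0 R1 R2 R3 R4 R5 R6 R7 : ℝ) (hs0 : 0 ≤ s) (hs1 : s ≤ 1 / 100000)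
    (hX : X ≤ B) (hF : F0 ≤ s * B)
    (p01 : P01 ≤ F0 - F1)
    (p10 : P10 ≤ F1 - F0)
    (p12 : P12 ≤ F1 - F2)
    (p13 : P13 ≤ F1 - F3)
    (p23 : P23 ≤ F2 - F3)
    (p31 : P31 ≤ F3 - F1)
    (p32 : P32 ≤ F3 - F2)
    (p34 : P34 ≤ F3 - F4)
    (p35 : P35 ≤ F3 - F5)
    (p36 : P36 ≤ F3 - F6)
    (p37 : P37 ≤ F3 - F7)
    (p45 : P45 ≤ F4 - F5)
    (p56 : P56 ≤ F5 - F6)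
    (p57 : P57 ≤ F5 - F7)
    (p64 : P64 ≤ F6 - F4)
    (p67 : P67 ≤ F6 - F7)
    (p73 : P73 ≤ F7 - F3)
    (r0 : R0 ≤ 0 - F0)
    (r1 : R1 ≤ 0 - F1)
    (r2 : R2 ≤ 0 - F2)
    (r3 : R3 ≤ 0 - F3)
    (r4 : R4 ≤ 0 - F4)
    (r5 : R5 ≤ 0 - F5)
    (r6 : R6 ≤ 0 - F6)
    (r7 : R7 ≤ 0 - F7)
    (hK : 0 ≤ 112 / 5 * s ^ 2 * X
      + ((1997 / 1000) + (-89591 / 2000) * s) * P01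
      + ((997 / 1000) + 0 * s) * P10
      + ((377 / 200) + (10921 / 2000) * s) * P12
      + ((9 / 20) + (-70) * s) * P13
      + ((2771 / 500) + (12811 / 500) * s) * P23
      + ((267 / 200) + (-20) * s) * P31
      + ((3657 / 1000) + 20 * s) * P32
      + ((131 / 1000) + (-28833 / 10000) * s) * P34
      + ((283 / 1000) + (-32587 / 2000) * s) * P35
      + ((31 / 100) + (-34761 / 5000) * s) * P36
      + ((287 / 1000) + (-32301 / 5000) * s) * P37
      + ((91 / 500) + 0 * s) * P45
      + ((133 / 500) + (-10) * s) * P56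
      + ((199 / 1000) + 0 * s) * P57
      + ((51 / 1000) + 0 * s) * P64
      + ((21 / 40) + (-10) * s) * P67
      + ((11 / 1000) + (-10) * s) * P73
      + (9 / 2000) * s * R0
      + (32 / 125) * s * R1
      + (323 / 2000) * s * R2
      + (13618 / 625) * s * R3
      + (28833 / 10000) * s * R4
      + (12587 / 2000) * s * R5
      + (34761 / 5000) * s * R6
      + (32301 / 5000) * s * R7) :
    F7 ≤ s * B - 112 / 5 * s ^ 2 * B := by
  have e01 := mul_nonneg (show (0 : ℝ) ≤ (1997 / 1000) + (-89591 / 2000) * s by linarith) (sub_nonneg.2 p01)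
  have e10 := mul_nonneg (show (0 : ℝ) ≤ (997 / 1000) + 0 * s by linarith) (sub_nonneg.2 p10)
  have e12 := mul_nonneg (show (0 : ℝ) ≤ (377 / 200) + (10921 / 2000) * s by linarith) (sub_nonneg.2 p12)
  have e13 := mul_nonneg (show (0 : ℝ) ≤ (9 / 20) + (-70) * s by linarith) (sub_nonneg.2 p13)
  have e23 := mul_nonneg (show (0 : ℝ) ≤ (2771 / 500) + (12811 / 500) * s by linarith) (sub_nonneg.2 p23)
  have e31 := mul_nonneg (show (0 : ℝ) ≤ (267 / 200) + (-20) * s by linarith) (sub_nonneg.2 p31)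
  have e32 := mul_nonneg (show (0 : ℝ) ≤ (3657 / 1000) + 20 * s by linarith) (sub_nonneg.2 p32)
  have e34 := mul_nonneg (show (0 : ℝ) ≤ (131 / 1000) + (-28833 / 10000) * s by linarith) (sub_nonneg.2 p34)
  have e35 := mul_nonneg (show (0 : ℝ) ≤ (283 / 1000) + (-32587 / 2000) * s by linarith) (sub_nonneg.2 p35)
  have e36 := mul_nonneg (show (0 : ℝ) ≤ (31 / 100) + (-34761 / 5000) * s by linarith) (sub_nonneg.2 p36)
  have e37 := mul_nonneg (show (0 : ℝ) ≤ (287 / 1000) + (-32301 / 5000) * s by linarith) (sub_nonneg.2 p37)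
  have e45 := mul_nonneg (show (0 : ℝ) ≤ (91 / 500) + 0 * s by linarith) (sub_nonneg.2 p45)
  have e56 := mul_nonneg (show (0 : ℝ) ≤ (133 / 500) + (-10) * s by linarith) (sub_nonneg.2 p56)
  have e57 := mul_nonneg (show (0 : ℝ) ≤ (199 / 1000) + 0 * s by linarith) (sub_nonneg.2 p57)
  have e64 := mul_nonneg (show (0 : ℝ) ≤ (51 / 1000) + 0 * s by linarith) (sub_nonneg.2 p64)
  have e67 := mul_nonneg (show (0 : ℝ) ≤ (21 / 40) + (-10) * s by linarith) (sub_nonneg.2 p67)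
  have e73 := mul_nonneg (show (0 : ℝ) ≤ (11 / 1000) + (-10) * s by linarith) (sub_nonneg.2 p73)
  have f0 := mul_nonneg (show (0 : ℝ) ≤ (9 / 2000) * s by linarith) (sub_nonneg.2 r0)
  have f1 := mul_nonneg (show (0 : ℝ) ≤ (32 / 125) * s by linarith) (sub_nonneg.2 r1)
  have f2 := mul_nonneg (show (0 : ℝ) ≤ (323 / 2000) * s by linarith) (sub_nonneg.2 r2)
  have f3 := mul_nonneg (show (0 : ℝ) ≤ (13618 / 625) * s by linarith) (sub_nonneg.2 r3)
  have f4 := mul_nonneg (show (0 : ℝ) ≤ (28833 / 10000) * s by linarith) (sub_nonneg.2 r4)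
  have f5 := mul_nonneg (show (0 : ℝ) ≤ (12587 / 2000) * s by linarith) (sub_nonneg.2 r5)
  have f6 := mul_nonneg (show (0 : ℝ) ≤ (34761 / 5000) * s by linarith) (sub_nonneg.2 r6)
  have f7 := mul_nonneg (show (0 : ℝ) ≤ (32301 / 5000) * s by linarith) (sub_nonneg.2 r7)
  have g0 := mul_nonneg (show (0 : ℝ) ≤ 1 - 224 / 5 * s by linarith) (sub_nonneg.2 hF)
  have g1 := mul_nonneg (show (0 : ℝ) ≤ 112 / 5 * s ^ 2 by positivity) (sub_nonneg.2 hX)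
  linear_combination e01 + e10 + e12 + e13 + e23 + e31 + e32 + e34 + e35 + e36 + e37 + e45 + e56 + e57 + e64 + e67 + e73
    + f0 + f1 + f2 + f3 + f4 + f5 + f6 + f7
    + g0 + g1 + hK

theorem one_cycle {n : ℕ} (s B : ℝ) (F : ℕ → ℝ) (x u : ℕ → E n)
    (hs0 : 0 ≤ s) (hs1 : s ≤ 1 / 100000) (hX : ‖x 0‖ ^ 2 ≤ B) (hF : F 0 ≤ s * B)
    (I : ∀ i j, inner ℝ (u j) (x i - x j) + 1 / 2 * ‖u i - u j‖ ^ 2 ≤ F i - F j)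
    (J : ∀ j, inner ℝ (u j) (0 - x j) + 1 / 2 * ‖0 - u j‖ ^ 2 ≤ 0 - F j)
    (h1 : x 1 = x 0 - ((3 / 2) : ℝ) • u 0) (h2 : x 2 = x 1 - ((11 / 5) : ℝ) • u 1) (h3 : x 3 = x 2 - ((3 / 2) : ℝ) • u 2) (h4 : x 4 = x 3 - (12 : ℝ) • u 3) (h5 : x 5 = x 4 - ((3 / 2) : ℝ) • u 4) (h6 : x 6 = x 5 - ((11 / 5) : ℝ) • u 5) (h7 : x 7 = x 6 - ((3 / 2) : ℝ) • u 6) :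
    F 7 ≤ s * B - 112 / 5 * s ^ 2 * B := by
  have hK := vector_certificate s (x 0) (x 1) (x 2) (x 3) (x 4) (x 5) (x 6) (x 7)
    (u 0) (u 1) (u 2) (u 3) (u 4) (u 5) (u 6) (u 7) hs0 hs1 h1 h2 h3 h4 h5 h6 h7
  exact assemble s B _ (F 0) (F 1) (F 2) (F 3) (F 4) (F 5) (F 6) (F 7) _ _ _ _ _ _ _ _ _ _ _ _ _ _ _ _ _ _ _ _ _ _ _ _ _ 
    hs0 hs1 hX hF (I 0 1) (I 1 0) (I 1 2) (I 1 3) (I 2 3) (I 3 1) (I 3 2) (I 3 4) (I 3 5) (I 3 6) (I 3 7) (I 4 5) (I 5 6) (I 5 7) (I 6 4) (I 6 7) (I 7 3) (J 0) (J 1) (J 2) (J 3) (J 4) (J 5) (J 6) (J 7) hK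

theorem gradient_min {n : ℕ} {g : E n → ℝ} {ystar : E n} (hmin : ∀ z, g ystar ≤ g z) :
    gradient g ystar = 0 := by
  have h : IsLocalMin g ystar := Filter.Eventually.of_forall hmin
  simp [gradient, h.fderiv_eq_zero]

theorem straightforward_core (h : ℕ → ℝ)
    (hdef : h = fun k =>
      if k % 7 = 3 then 12 else if k % 7 = 1 ∨ k % 7 = 5 then 11 / 5 else 3 / 2) :
    IsStraightforward 7 h (1e-9) (1e-5) := by
  intro n L D δ hL hD hδ0 hδ1 g hc hs ystar hmin y hy0 hg0 hstep
  have hB : 0 < L * D ^ 2 := by positivity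
  have hgs := gradient_min hmin
  have key := one_cycle (δ / (L * D ^ 2)) (D ^ 2) (fun k => (g (y k) - g ystar) / L)
    (fun k => y k - ystar) (fun k => (1 / L) • gradient g (y k))
    (by positivity)
    (by rw [div_le_iff₀ hB]; norm_num at hδ1 ⊢; linarith)
    (by have := norm_nonneg (y 0 - ystar); gcongr)
    (by
      rw [div_le_iff₀ hL]
      have : δ / (L * D ^ 2) * D ^ 2 * L = δ := by field_simp
      rw [this]; exact hg0)
    (by
      intro i j
      have := interpolation hL hc hs (y i) (y j)
      have e : (y i - ystar) - (y j - ystar) = y i - y j := by abel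
      simp only [e]
      refine this.trans (le_of_eq ?_)
      ring)
    (by
      intro j
      have := interpolation hL hc hs ystar (y j)
      rw [hgs, smul_zero] at this
      have e : 0 - (y j - ystar) = ystar - y j := by abel
      simp only [e]
      refine this.trans (le_of_eq ?_)
      ring)
  have st : ∀ k < 7, ∀ c : ℝ, h k = c →
      y (k + 1) - ystar = y k - ystar - c • ((1 / L) • gradient g (y k)) := by
    intro k hk c hkc
    rw [hstep k hk, hkc, smul_smul]
    have : c * (1 / L) = c / L := by ring
    rw [this]
    abel
  have key2 := key (st 0 (by norm_num) _ (by simp [hdef])) (st 1 (by norm_num) _ (by simp [hdef]))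
    (st 2 (by norm_num) _ (by simp [hdef])) (st 3 (by norm_num) _ (by simp [hdef]))
    (st 4 (by norm_num) _ (by simp [hdef])) (st 5 (by norm_num) _ (by simp [hdef]))
    (st 6 (by norm_num) _ (by simp [hdef]))
  rw [div_le_iff₀ hL] at key2
  have e1 : (δ / (L * D ^ 2) * D ^ 2 - 112 / 5 * (δ / (L * D ^ 2)) ^ 2 * D ^ 2) * L
      = δ - (112 / 5) / (L * D ^ 2) * δ ^ 2 := by
    field_simp
  rw [e1] at key2
  have e2 : (∑ i ∈ Finset.range 7, (h i - 1e-9)) ≤ 112 / 5 := by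
    simp [Finset.sum_range_succ, hdef]
    norm_num
  have e3 : (∑ i ∈ Finset.range 7, (h i - 1e-9)) / (L * D ^ 2) * δ ^ 2
      ≤ (112 / 5) / (L * D ^ 2) * δ ^ 2 := by gcongr
  linarith

/-- Recursion with quadratic decrease gives the `M/(ck) + C/k²` rate. -/
theorem seq_rate (e : ℕ → ℝ) (M c : ℝ) (hM : 0 < M) (hc : 0 < c) (hc' : c ≤ 23)
    (he : ∀ k, 0 ≤ e k) (hmono : ∀ k, e k ≤ e 0)
    (h1 : ∀ k, e k ≤ M * 1e-5 → e (k + 1) ≤ e k - c / M * e k ^ 2)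
    (h2 : ∀ k, M * 1e-5 ≤ e k → e (k + 1) ≤ e k * (1 - c * 1e-5)) :
    ∃ C : ℝ, 0 ≤ C ∧ ∀ k : ℕ, 0 < k → e k ≤ M / (c * k) + C / (k : ℝ) ^ 2 := by
  have hex : ∃ s, e s ≤ M * 1e-5 := by
    by_contra! hcon
    have hq0 : 0 ≤ 1 - c * 1e-5 := by norm_num; linarith
    have hq1 : 1 - c * 1e-5 < 1 := by norm_num; linarith
    have hpow : ∀ k, e k ≤ e 0 * (1 - c * 1e-5) ^ k := by
      intro k
      induction k with
      | zero => simp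
      | succ k ih =>
        calc e (k + 1) ≤ e k * (1 - c * 1e-5) := h2 k (hcon k).le
          _ ≤ e 0 * (1 - c * 1e-5) ^ k * (1 - c * 1e-5) := by gcongr
          _ = _ := by ring
    have he0 : 0 < e 0 := lt_trans (by positivity) (hcon 0)
    obtain ⟨k, hk⟩ := exists_pow_lt_of_lt_one (show 0 < M * 1e-5 / e 0 by positivity) hq1
    rw [lt_div_iff₀ he0] at hk
    have := hpow k
    have := hcon k
    linarith
  obtain ⟨s, hs⟩ := hex
  have hlow : ∀ j, e (s + j) ≤ M * 1e-5 := by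
    intro j
    induction j with
    | zero => exact hs
    | succ j ih =>
      have := h1 _ ih
      have h3 : 0 ≤ c / M * e (s + j) ^ 2 := by positivity
      rw [← add_assoc]
      linarith
  have hrate : ∀ j : ℕ, c / M * e (s + j) * j ≤ 1 := by
    intro j
    induction j with
    | zero => simp
    | succ j ih =>
      have h3 := h1 _ (hlow j)
      set z := c / M * e (s + j) with hz
      have hz0 : 0 ≤ z := mul_nonneg (by positivity) (he _)
      have hz1 : z ≤ 1 := by
        have : z ≤ c / M * (M * 1e-5) := by
          rw [hz]; have := hlow j; gcongr
        have h5 : c / M * (M * 1e-5) = c * 1e-5 := by field_simp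
        rw [h5] at this
        norm_num at this
        linarith
      have h4 : c / M * e (s + (j + 1)) ≤ z - z ^ 2 := by
        have := mul_le_mul_of_nonneg_left h3 (show 0 ≤ c / M by positivity)
        rw [← add_assoc]
        refine this.trans (le_of_eq ?_)
        rw [hz]; ring
      have h5 : (0 : ℝ) ≤ (j : ℝ) + 1 := by positivity
      push_cast
      have h6 := mul_le_mul_of_nonneg_right h4 h5
      nlinarith [mul_nonneg (sub_nonneg.2 ih) (sub_nonneg.2 hz1), sq_nonneg z]
  refine ⟨M * s * (s + 1) / c + e 0 * s ^ 2, ?_, ?_⟩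
  · have := he 0
    positivity
  intro k hk
  have hkR : (0 : ℝ) < k := by exact_mod_cast hk
  rcases le_or_gt k s with hks | hks
  · have hksR : (k : ℝ) ≤ s := by exact_mod_cast hks
    have a1 : e 0 ≤ e 0 * s ^ 2 / (k : ℝ) ^ 2 := by
      rw [le_div_iff₀ (by positivity)]
      have := he 0
      gcongr
    have a2 : 0 ≤ M / (c * k) := by positivity
    have a3 : 0 ≤ M * s * (s + 1) / c / (k : ℝ) ^ 2 := by positivity
    have := hmono k
    rw [add_div]
    linarith
  · obtain ⟨j, rfl⟩ := Nat.exists_eq_add_of_lt hks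
    have a1 := hrate (j + 1)
    rw [← add_assoc] at a1
    push_cast at a1 ⊢
    have hS : (0 : ℝ) ≤ s := by positivity
    have hJ : (0 : ℝ) ≤ j := by positivity
    set S : ℝ := (s : ℝ)
    set J : ℝ := (j : ℝ)
    have a2 : e (s + j + 1) ≤ M / (c * (J + 1)) := by
      rw [le_div_iff₀ (by positivity)]
      have : c / M * e (s + j + 1) * (J + 1) = e (s + j + 1) * (c * (J + 1)) / M := by
        field_simp
      rw [this, div_le_one hM] at a1
      exact a1
    have a3 : M / (c * (J + 1)) ≤ M / (c * (S + J + 1)) + M * S * (S + 1) / c / (S + J + 1) ^ 2 := by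
      have e1 : M / (c * (S + J + 1)) + M * S * (S + 1) / c / (S + J + 1) ^ 2
          - M / (c * (J + 1)) = M * S * (S * J) / (c * (J + 1) * (S + J + 1) ^ 2) := by
        field_simp
        ring
      have e2 : 0 ≤ M * S * (S * J) / (c * (J + 1) * (S + J + 1) ^ 2) := by positivity
      linarith
    have a4 : 0 ≤ e 0 * S ^ 2 / (S + J + 1) ^ 2 := by
      have := he 0
      positivity
    rw [add_div]
    linarith

/-- Theorem 3.6 (case `t = 7`): the pattern `h = (3/2, 11/5, 3/2, 12, 3/2, 11/5, 3/2)`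
is `10⁻⁹`-straightforward with parameter `Δ = 10⁻⁵`; consequently gradient descent cycling
through these stepsizes over `L` satisfies
`f (x T) - f x⋆ ≤ L D² / ((16/5 - 10⁻⁹) T) + C/T²` for all `T > 0` divisible by `7`. -/
theorem seven_step_pattern_rate
    (h : ℕ → ℝ)
    (hdef : h = fun k =>
      if k % 7 = 3 then 12 else if k % 7 = 1 ∨ k % 7 = 5 then 11 / 5 else 3 / 2) :
    IsStraightforward 7 h (1e-9) (1e-5)
    ∧ (∀ (n : ℕ) (L : ℝ), 0 < L →
        ∀ f : E n → ℝ, ConvexOn ℝ Set.univ f → IsLSmooth L f →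
          ∀ xstar : E n, (∀ z, f xstar ≤ f z) →
            ∀ (x : ℕ → E n) (x0 : E n), x 0 = x0 →
              ∀ D : ℝ, IsLUB {r : ℝ | ∃ z : E n, f z ≤ f x0 ∧ r = ‖z - xstar‖} D →
                (∀ k : ℕ, x (k + 1) = x k - (h (k % 7) / L) • gradient f (x k)) →
                ∃ C : ℝ, 0 ≤ C ∧ ∀ T : ℕ, 0 < T → 7 ∣ T →
                  f (x T) - f xstar ≤
                    L * D ^ 2 / ((16 / 5 - 1e-9) * T) + C / (T : ℝ) ^ 2) := by
  have hSF := straightforward_core h hdef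
  refine ⟨hSF, ?_⟩
  intro n L hL f hf hs xstar hmin x x0 hx0 D hD hstep
  have hmem : ∀ z, f z ≤ f x0 → ‖z - xstar‖ ≤ D := fun z hz => hD.1 ⟨z, hz, rfl⟩
  have hD0 : 0 ≤ D := (norm_nonneg _).trans (hmem xstar (hmin _))
  have hsum : (∑ i ∈ Finset.range 7, (h i - 1e-9)) = 7 * (16 / 5 - 1e-9) := by
    simp [Finset.sum_range_succ, hdef]
    norm_num
  set c : ℝ := 7 * (16 / 5 - 1e-9) with hcdef
  have hc0 : 0 < c := by rw [hcdef]; norm_num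
  have hc1 : c ≤ 23 := by rw [hcdef]; norm_num
  set e : ℕ → ℝ := fun k => f (x (7 * k)) - f xstar with hedef
  have he : ∀ k, 0 ≤ e k := fun k => sub_nonneg.2 (hmin _)
  -- one pass of the pattern
  have cyc : ∀ k, e k ≤ e 0 → ∀ D' : ℝ, 0 < D' → D ≤ D' → e k ≤ L * D' ^ 2 * 1e-5 →
      e (k + 1) ≤ e k - c / (L * D' ^ 2) * e k ^ 2 := by
    intro k hk D' hD' hDD' hek
    have hx : f (x (7 * k)) ≤ f x0 := by
      have : f (x (7 * k)) - f xstar ≤ f (x (7 * 0)) - f xstar := hk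
      rw [mul_zero, hx0] at this
      linarith
    have := hSF n L D' (e k) hL hD' (he k) hek f hf hs xstar hmin (fun j => x (7 * k + j))
      ((hmem _ hx).trans hDD') le_rfl (by
        intro j hj
        have h1 := hstep (7 * k + j)
        have h2 : (7 * k + j) % 7 = j := by omega
        rw [h2] at h1
        exact h1)
    rw [hsum] at this
    exact this
  have hmono : ∀ k, e k ≤ e 0 := by
    intro k
    induction k with
    | zero => exact le_rfl
    | succ k ih =>
      have hr : 0 < D + 1 + e k / (L * 1e-5) := by have := he k; positivity
      have hr1 : 1 ≤ D + 1 + e k / (L * 1e-5) := by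
        have : 0 ≤ e k / (L * 1e-5) := div_nonneg (he k) (by positivity)
        linarith
      have hr2 : e k / (L * 1e-5) ≤ (D + 1 + e k / (L * 1e-5)) ^ 2 := by nlinarith
      have := cyc k ih (D + 1 + e k / (L * 1e-5)) hr
        (by have : 0 ≤ e k / (L * 1e-5) := div_nonneg (he k) (by positivity)
            linarith)
        (by rw [div_le_iff₀ (by positivity)] at hr2
            linarith)
      have h3 : 0 ≤ c / (L * (D + 1 + e k / (L * 1e-5)) ^ 2) * e k ^ 2 := by positivity
      linarith
  rcases hD0.eq_or_lt with hDz | hDpos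
  · refine ⟨0, le_rfl, ?_⟩
    rintro T hT ⟨k, rfl⟩
    have h1 : x 0 = xstar := by
      have := hmem (x 0) (by rw [hx0])
      rw [← hDz] at this
      exact sub_eq_zero.1 (norm_le_zero_iff.1 this)
    have h2 := hmono k
    have h3 : e 0 = 0 := by simp [hedef, h1]
    rw [h3] at h2
    rw [← hDz]
    have h4 : f (x (7 * k)) - f xstar ≤ 0 := h2
    simpa using h4
  · have hM : 0 < L * D ^ 2 := by positivity
    obtain ⟨C, hC0, hC⟩ := seq_rate e (L * D ^ 2) c hM hc0 hc1 he hmono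
      (fun k hk => cyc k (hmono k) D hDpos le_rfl hk)
      (by
        intro k hk
        have hek : 0 < e k := lt_of_lt_of_le (by positivity) hk
        have hq : 0 < e k / (L * 1e-5) := by positivity
        have hsq : (Real.sqrt (e k / (L * 1e-5))) ^ 2 = e k / (L * 1e-5) := Real.sq_sqrt hq.le
        have hLe : L * (e k / (L * 1e-5)) = e k / 1e-5 := by
          field_simp
        have := cyc k (hmono k) (Real.sqrt (e k / (L * 1e-5))) (Real.sqrt_pos.2 hq)
          (by
            apply Real.le_sqrt_of_sq_le
            rw [le_div_iff₀ (by positivity)]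
            linarith)
          (by
            rw [hsq, hLe]
            apply le_of_eq
            field_simp)
        rw [hsq, hLe] at this
        refine this.trans (le_of_eq ?_)
        field_simp)
    refine ⟨49 * C, by positivity, ?_⟩
    rintro T hT ⟨k, rfl⟩
    have hk : 0 < k := by omega
    have hkR : (0 : ℝ) < k := by exact_mod_cast hk
    refine (hC k hk).trans (le_of_eq ?_)
    have a1 : L * D ^ 2 / ((16 / 5 - 1e-9) * ((7 * k : ℕ) : ℝ)) = L * D ^ 2 / (c * k) := by
      congr 1
      rw [hcdef]
      push_cast
      ring
    have a2 : 49 * C / ((7 * k : ℕ) : ℝ) ^ 2 = C / (k : ℝ) ^ 2 := by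
      push_cast
      field_simp
      ring
    rw [a1, a2]

end
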